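/- The diagonal quaternary quadratic form x² + 2y² + 4z² + 10w² primitively represents every positive integer except exactly 24: for every positive integer n ≠ 24 there exist integers x, y, z, w with gcd(x,y,z,w) = 1 and x² + 2y² + 4z² + 10w² = n, and no such representation exists for n = 24. -/

import Mathlib

/-- Every integer is congruent modulo `A` to one of absolute value at most `A / 2`. -/
lemma exists_small_shift (A B : ℤ) (hA : 0 < A) :
    ∃ k : ℤ, 4 * (B + k * A) ^ 2 ≤ A ^ 2 := by
  refine ⟨-((2 * B + A) / (2 * A)), ?_⟩
  have h1 := Int.mul_ediv_add_emod (2 * B + A) (2 * A)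
  have h2 := Int.emod_nonneg (2 * B + A) (show 2 * A ≠ 0 by omega)
  have h3 := Int.emod_lt_of_pos (2 * B + A) (show 0 < 2 * A by omega)
  generalize (2 * B + A) / (2 * A) = q at *
  generalize (2 * B + A) % (2 * A) = r at *
  have h : 2 * (B + -q * A) = r - A := by linarith
  have : (2 * (B + -q * A)) ^ 2 ≤ A ^ 2 := by
    rw [h]
    nlinarith
  linarith

/-- A positive definite binary quadratic form has a unimodular substitution making its leading
coefficient at most `2 * √(D / 3)`, where `D` is the determinant. -/
lemma binary_reduction (A B C : ℤ) (hA : 0 < A) (hD : 0 < A * C - B ^ 2) :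
    ∃ p q r s : ℤ, p * s - q * r = 1 ∧ 0 < A * p ^ 2 + 2 * B * p * r + C * r ^ 2 ∧
      3 * (A * p ^ 2 + 2 * B * p * r + C * r ^ 2) ^ 2 ≤ 4 * (A * C - B ^ 2) := by
  induction hm : A.toNat using Nat.strong_induction_on generalizing A B C with
  | _ m ih =>
  by_cases hle : 3 * A ^ 2 ≤ 4 * (A * C - B ^ 2)
  · exact ⟨1, 0, 0, 1, by ring, by simpa using hA, by simpa using hle⟩
  · obtain ⟨k, hk⟩ := exists_small_shift A B hA
    set C' := A * k ^ 2 + 2 * B * k + C with hC'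
    have hdet : A * C' - (B + k * A) ^ 2 = A * C - B ^ 2 := by rw [hC']; ring
    have hpos : 0 < C' := by
      by_contra hc
      nlinarith [sq_nonneg (B + k * A)]
    have hlt : C' < A := by
      by_contra hc
      nlinarith
    obtain ⟨p, q, r, s, h1, h2, h3⟩ :=
      ih C'.toNat (by omega) C' (-(B + k * A)) A hpos (by linarith) rfl
    have he : A * (-r + k * p) ^ 2 + 2 * B * (-r + k * p) * p + C * p ^ 2 =
        C' * p ^ 2 + 2 * -(B + k * A) * p * r + A * r ^ 2 := by rw [hC']; ring
    refine ⟨-r + k * p, -s + k * q, p, q, by linear_combination h1, by rw [he]; exact h2, ?_⟩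
    rw [he]
    linarith

lemma binary_unimodular_sum_two_squares (A B C : ℤ) (hA : 0 < A) (hD : A * C - B ^ 2 = 1)
    (y z : ℤ) : ∃ u v : ℤ, A * y ^ 2 + 2 * B * y * z + C * z ^ 2 = u ^ 2 + v ^ 2 := by
  obtain ⟨p, q, r, s, h1, h2, h3⟩ := binary_reduction A B C hA (by omega)
  set A' := A * p ^ 2 + 2 * B * p * r + C * r ^ 2 with hA'
  have hone : A' = 1 := by nlinarith
  set B' := A * p * q + B * (p * s + q * r) + C * r * s with hB'
  set C' := A * q ^ 2 + 2 * B * q * s + C * s ^ 2 with hC'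
  have hdet : A' * C' - B' ^ 2 = 1 := by
    rw [hA', hB', hC']
    linear_combination (p * s - q * r) ^ 2 * hD + (p * s - q * r + 1) * h1
  have hval : A * y ^ 2 + 2 * B * y * z + C * z ^ 2 =
      A' * (s * y - q * z) ^ 2 + 2 * B' * (s * y - q * z) * (-r * y + p * z)
        + C' * (-r * y + p * z) ^ 2 := by
    rw [hA', hB', hC']
    linear_combination
      -(A * y ^ 2 + 2 * B * y * z + C * z ^ 2) * (p * s - q * r + 1) * h1
  refine ⟨s * y - q * z + B' * (-r * y + p * z), -r * y + p * z, ?_⟩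
  rw [hval]
  rw [hone] at hdet ⊢
  linear_combination (-r * y + p * z) ^ 2 * hdet

/-- A positive definite integral ternary form of determinant one only takes values that are
sums of three squares. -/
lemma ternary_unimodular_sum_three_squares (a b c d e f : ℤ) (ha : 0 < a)
    (hG : 0 < a * b - d ^ 2)
    (hdet : a * b * c + 2 * d * e * f - a * f ^ 2 - b * e ^ 2 - c * d ^ 2 = 1) (x y z : ℤ) :
    ∃ u v w : ℤ, a * x ^ 2 + b * y ^ 2 + c * z ^ 2 + 2 * d * x * y + 2 * e * x * z
      + 2 * f * y * z = u ^ 2 + v ^ 2 + w ^ 2 := by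
  induction hm : a.toNat using Nat.strong_induction_on generalizing a b c d e f x y z with
  | _ m ih =>
  rcases (show a = 1 ∨ 2 ≤ a by omega) with rfl | ha2
  · obtain ⟨u, v, huv⟩ := binary_unimodular_sum_two_squares (b - d ^ 2) (f - d * e) (c - e ^ 2)
      (by linarith) (by linear_combination hdet) y z
    exact ⟨x + d * y + e * z, u, v, by linear_combination huv⟩
  · have hGdet : (a * b - d ^ 2) * (a * c - e ^ 2) - (a * f - d * e) ^ 2 = a := by
      linear_combination a * hdet
    obtain ⟨p, q, r, s, h1, h2, h3⟩ :=
      binary_reduction (a * b - d ^ 2) (a * f - d * e) (a * c - e ^ 2) hG (by omega)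
    rw [hGdet] at h3
    set g := (a * b - d ^ 2) * p ^ 2 + 2 * (a * f - d * e) * p * r + (a * c - e ^ 2) * r ^ 2
      with hg
    obtain ⟨k, hk⟩ := exists_small_shift a (d * p + e * r) ha
    set d' := d * p + e * r + k * a with hd'
    set e' := d * q + e * s with he'
    set b' := b * p ^ 2 + 2 * f * p * r + c * r ^ 2 + 2 * k * (d * p + e * r) + k ^ 2 * a with hb'
    set c' := b * q ^ 2 + 2 * f * q * s + c * s ^ 2 with hc'
    set f' := b * p * q + f * (p * s + q * r) + c * r * s + k * e' with hf'
    have hgb : a * b' - d' ^ 2 = g := by rw [hb', hd', hg]; ring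
    have hbpos : 0 < b' := by
      by_contra hc
      nlinarith [sq_nonneg d']
    have hblt : b' < a := by
      by_contra hc
      have hab : a * a ≤ a * b' := mul_le_mul_of_nonneg_left (not_lt.mp hc) ha.le
      have h4 : 3 * a ^ 2 ≤ 4 * g := by linarith
      have h5 : (3 * a ^ 2) ^ 2 ≤ (4 * g) ^ 2 := pow_le_pow_left₀ (by positivity) h4 2
      have h6 : 8 * a ≤ a ^ 4 := by
        have : 0 ≤ a * (a - 2) * (a ^ 2 + 2 * a + 4) := by
          have : 0 ≤ a - 2 := by omega
          positivity
        linarith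
      linarith
    have hdet' : b' * a * c' + 2 * d' * f' * e' - b' * e' ^ 2 - a * f' ^ 2 - c' * d' ^ 2 = 1 := by
      rw [hb', hd', hf', hc', he']
      linear_combination (p * s - q * r) ^ 2 * hdet + (p * s - q * r + 1) * h1
    obtain ⟨u, v, w, huvw⟩ := ih b'.toNat (by omega) b' a c' d' f' e' hbpos (by linarith) hdet'
      (s * y - q * z) (x - k * (s * y - q * z)) (-r * y + p * z) rfl
    refine ⟨u, v, w, huvw ▸ ?_⟩
    have hy : p * (s * y - q * z) + q * (-r * y + p * z) = y := by linear_combination y * h1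
    have hz : r * (s * y - q * z) + s * (-r * y + p * z) = z := by linear_combination z * h1
    generalize s * y - q * z = Y at *
    generalize -r * y + p * z = Z at *
    rw [← hy, ← hz, hb', hd', hf', hc', he']
    ring

lemma sum_three_squares_of_dvd (n b : ℕ) (x : ℤ) (hb : 0 < b) (hbn : 1 < b * n)
    (h : (b * n - 1 : ℤ) ∣ x ^ 2 + b) : ∃ u v w : ℤ, u ^ 2 + v ^ 2 + w ^ 2 = n := by
  obtain ⟨t, ht⟩ := h
  have hb' : (0 : ℤ) < b := by exact_mod_cast hb
  have hbn' : (1 : ℤ) < b * n := by exact_mod_cast hbn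
  have htpos : 0 < t := by
    by_contra hc
    nlinarith [sq_nonneg x]
  obtain ⟨u, v, w, h⟩ := ternary_unimodular_sum_three_squares t (b * n - 1) n x 1 0 htpos
    (by linarith) (by linear_combination (-n : ℤ) * ht) 0 0 1
  exact ⟨u, v, w, by linarith⟩

lemma exists_dvd_sq_add_of_jacobiSym {p b : ℕ} (hp : p.Prime) (h : jacobiSym (-b) p = 1) :
    ∃ x : ℤ, (p : ℤ) ∣ x ^ 2 + b := by
  have := Fact.mk hp
  obtain ⟨r, hr⟩ := ZMod.isSquare_of_jacobiSym_eq_one h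
  obtain ⟨x, rfl⟩ := ZMod.intCast_surjective r
  refine ⟨x, (ZMod.intCast_zmod_eq_zero_iff_dvd _ p).mp ?_⟩
  push_cast at hr ⊢
  linear_combination -hr

lemma exists_prime_eq_mul_add {q a : ℕ} (hq : q ≠ 0) (h : a.Coprime q) :
    ∃ p m : ℕ, p.Prime ∧ p = q * m + a := by
  obtain ⟨p, hpa, hp, hmod⟩ := Nat.forall_exists_prime_gt_and_modEq a hq h
  obtain ⟨m, hm⟩ := (Nat.modEq_iff_dvd' hpa.le).mp hmod.symm
  exact ⟨p, m, hp, by omega⟩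

lemma sum_three_squares_of_mod_four_eq_two {n : ℕ} (hn : n % 4 = 2) :
    ∃ x y z : ℤ, x ^ 2 + y ^ 2 + z ^ 2 = n := by
  have hcop : (n - 1).Coprime (4 * n) := by
    refine Nat.Coprime.mul_right ?_ ?_
    · exact (Nat.Coprime.pow_right 2 (Nat.coprime_two_right.mpr
        (Nat.odd_iff.mpr (by omega : (n - 1) % 2 = 1))) : (n - 1).Coprime (2 ^ 2))
    · rw [← Nat.isCoprime_iff_coprime]
      exact ⟨-1, 1, by push_cast [show 1 ≤ n by omega]; ring⟩
  obtain ⟨p, m, hp, hpm⟩ := exists_prime_eq_mul_add (by omega) hcop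
  have hpn : p + 1 = (4 * m + 1) * n := by
    have : (4 * m + 1) * n = 4 * n * m + n := by ring
    omega
  have hpnZ : (p + 1 : ℤ) = (4 * m + 1) * n := by exact_mod_cast hpn
  have hp4 : p % 4 = 1 := by rw [hpm, mul_assoc]; omega
  have hodd : Odd (4 * m + 1) := ⟨2 * m, by ring⟩
  have hpodd : Odd p := Nat.odd_iff.mpr (by omega)
  have hJ : jacobiSym (-(4 * m + 1 : ℕ)) p = 1 := by
    rw [← neg_one_mul, jacobiSym.mul_left, jacobiSym.at_neg_one hpodd,
      ZMod.χ₄_nat_one_mod_four hp4, one_mul,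
      jacobiSym.quadratic_reciprocity_one_mod_four (by omega) hpodd,
      jacobiSym.mod_left' (a₂ := -1), jacobiSym.at_neg_one hodd,
      ZMod.χ₄_nat_one_mod_four (by omega)]
    refine (Int.modEq_iff_dvd.mpr ⟨n, ?_⟩).symm
    push_cast
    linarith
  obtain ⟨x, hx⟩ := exists_dvd_sq_add_of_jacobiSym hp hJ
  have := hp.two_le
  refine sum_three_squares_of_dvd n (4 * m + 1) x (by omega) (by omega) ?_
  rwa [show ((4 * m + 1 : ℕ) * n - 1 : ℤ) = p by
    push_cast
    linarith]

/-- The common part of the odd cases: `2 * p + 1 = b * n` for a prime `p` with suitable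
residues. -/
lemma sum_three_squares_of_odd {n c a : ℕ} (ha : 2 * a + 1 = c * n) (haodd : a % 2 = 1)
    (hn : n % 2 = 1) (hc : c % 8 = 1 ∨ c % 8 = 3) (hac : a % 4 = 1 ∨ c % 4 = 3) :
    ∃ x y z : ℤ, x ^ 2 + y ^ 2 + z ^ 2 = n := by
  have hcop : a.Coprime (4 * n) := by
    refine Nat.Coprime.mul_right ?_ ?_
    · exact (Nat.Coprime.pow_right 2 (Nat.coprime_two_right.mpr
        (Nat.odd_iff.mpr haodd)) : a.Coprime (2 ^ 2))
    · rw [← Nat.isCoprime_iff_coprime]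
      have := congrArg (Nat.cast (R := ℤ)) ha
      push_cast at this
      exact ⟨-2, c, by linarith⟩
  obtain ⟨p, m, hp, hpm⟩ := exists_prime_eq_mul_add (by omega) hcop
  obtain ⟨b, hb⟩ : ∃ b, b = 8 * m + c := ⟨_, rfl⟩
  have hpn : 2 * p + 1 = b * n := by
    have : b * n = 2 * (4 * n * m) + c * n := by rw [hb]; ring
    omega
  have hpnZ : (2 * p + 1 : ℤ) = b * n := by exact_mod_cast hpn
  have hp4 : p % 4 = a % 4 := by rw [hpm, mul_assoc]; omega
  have hodd : Odd b := Nat.odd_iff.mpr (by omega)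
  have hpodd : Odd p := Nat.odd_iff.mpr (by omega)
  have hpb : jacobiSym p b = 1 := by
    have h1 : jacobiSym (-2) b = 1 := by
      rw [jacobiSym.at_neg_two hodd, ZMod.χ₈'_nat_eq_if_mod_eight, if_neg (by omega),
        if_pos (by omega)]
    have h2 : jacobiSym (-2 * p) b = 1 := by
      rw [jacobiSym.mod_left' (a₂ := 1), jacobiSym.one_left]
      exact Int.modEq_iff_dvd.mpr ⟨n, by linarith⟩
    rwa [jacobiSym.mul_left, h1, one_mul] at h2
  have hJ : jacobiSym (-b) p = 1 := by
    rw [← neg_one_mul, jacobiSym.mul_left, jacobiSym.at_neg_one hpodd]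
    rcases (show p % 4 = 1 ∨ p % 4 = 3 ∧ b % 4 = 3 by omega) with h | ⟨h, h'⟩
    · rw [ZMod.χ₄_nat_one_mod_four h, one_mul,
        jacobiSym.quadratic_reciprocity_one_mod_four' hodd h, hpb]
    · rw [ZMod.χ₄_nat_three_mod_four h,
        jacobiSym.quadratic_reciprocity_three_mod_four h' h, hpb]
      rfl
  obtain ⟨x, hx⟩ := exists_dvd_sq_add_of_jacobiSym hp hJ
  obtain ⟨y, hy, hyodd⟩ : ∃ y : ℤ, (p : ℤ) ∣ y ^ 2 + b ∧ y % 2 = 1 := by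
    rcases Int.emod_two_eq_zero_or_one x with h | h
    · refine ⟨x + p, ?_, by omega⟩
      have : (x + p) ^ 2 + b = x ^ 2 + b + p * (2 * x + p) := by ring
      rw [this]
      exact dvd_add hx (dvd_mul_right _ _)
    · exact ⟨x, hx, h⟩
  have h2 : (2 : ℤ) ∣ y ^ 2 + b := by
    have hb1 : (b : ℤ) % 2 = 1 := by omega
    exact Int.dvd_of_emod_eq_zero (by rw [Int.add_emod, pow_two, Int.mul_emod, hyodd, hb1]; rfl)
  have hcop2 : IsCoprime (2 : ℤ) p := by
    exact_mod_cast Nat.isCoprime_iff_coprime.mpr (Nat.coprime_two_left.mpr hpodd)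
  have := hp.two_le
  refine sum_three_squares_of_dvd n b y (by omega) (by omega) ?_
  rw [← hpnZ, add_sub_cancel_right]
  exact hcop2.mul_dvd h2 hy

/-- The three squares theorem for integers not divisible by four. -/
lemma sum_three_squares {n : ℕ} (hn : n % 4 = 1 ∨ n % 4 = 2 ∨ n % 8 = 3) :
    ∃ x y z : ℤ, x ^ 2 + y ^ 2 + z ^ 2 = n := by
  rcases hn with hn | hn | hn
  · exact sum_three_squares_of_odd (c := 3) (a := (3 * n - 1) / 2) (by omega) (by omega)
      (by omega) (by omega) (by omega)
  · exact sum_three_squares_of_mod_four_eq_two hn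
  · exact sum_three_squares_of_odd (c := 1) (a := (n - 1) / 2) (by omega) (by omega)
      (by omega) (by omega) (by omega)

lemma sq_emod_four (x : ℤ) : x % 2 = 0 ∧ x ^ 2 % 4 = 0 ∨ x % 2 = 1 ∧ x ^ 2 % 4 = 1 := by
  rcases Int.even_or_odd' x with ⟨k, rfl | rfl⟩
  · exact .inl ⟨by omega, by ring_nf; omega⟩
  · exact .inr ⟨by omega, by ring_nf; omega⟩

/-- A sum of three squares congruent to one or two modulo four has squares of both parities. -/
lemma exists_mixed_parity {m : ℕ} (hm : m % 4 = 1 ∨ m % 4 = 2) :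
    ∃ x y z : ℤ, x ^ 2 + y ^ 2 + z ^ 2 = m ∧ (x + y) % 2 = 1 := by
  obtain ⟨x, y, z, h⟩ := sum_three_squares (n := m) (by omega)
  by_cases hxy : (x + y) % 2 = 1
  · exact ⟨x, y, z, h, hxy⟩
  · refine ⟨x, z, y, by linarith, ?_⟩
    have := sq_emod_four x
    have := sq_emod_four y
    have := sq_emod_four z
    omega

/-- Two of the squares have the same parity, so they sum to twice a sum of two squares. -/
lemma sum_sq_add_two_mul_of_sum_three_squares {m : ℕ}
    (hm : ∃ x y z : ℤ, x ^ 2 + y ^ 2 + z ^ 2 = m) :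
    ∃ a y z : ℤ, y ^ 2 + 2 * a ^ 2 + 2 * z ^ 2 = m := by
  have key : ∀ x y z : ℤ, x ^ 2 + y ^ 2 + z ^ 2 = m → (x + y) % 2 = 0 →
      ∃ a y z : ℤ, y ^ 2 + 2 * a ^ 2 + 2 * z ^ 2 = m := by
    intro x y z h hxy
    obtain ⟨a, ha⟩ := Int.dvd_of_emod_eq_zero hxy
    obtain rfl : x = 2 * a - y := by linarith
    exact ⟨a, z, a - y, by linarith⟩
  obtain ⟨x, y, z, h⟩ := hm
  rcases (show (x + y) % 2 = 0 ∨ (x + z) % 2 = 0 ∨ (y + z) % 2 = 0 by omega) with h' | h' | h'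
  · exact key x y z h h'
  · exact key x z y (by linarith) h'
  · exact key y z x (by linarith) h'

lemma exists_eq_sq_add_two_sq_add_four_sq {k : ℕ} (hk : k % 2 = 1) :
    ∃ x y z : ℤ, x ^ 2 + 2 * y ^ 2 + 4 * z ^ 2 = k := by
  obtain ⟨a, c, b, h⟩ := sum_sq_add_two_mul_of_sum_three_squares
    (sum_three_squares (n := 2 * k) (by omega))
  push_cast at h
  have hc : c % 2 = 0 := by have := sq_emod_four c; omega
  obtain ⟨c, rfl⟩ := Int.dvd_of_emod_eq_zero hc
  have hab : a % 2 = 0 ∨ b % 2 = 0 := by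
    have := sq_emod_four a
    have := sq_emod_four b
    have : 2 * c ^ 2 + a ^ 2 + b ^ 2 = k := by linarith
    omega
  rcases hab with h' | h'
  · obtain ⟨a, rfl⟩ := Int.dvd_of_emod_eq_zero h'
    exact ⟨b, c, a, by linarith⟩
  · obtain ⟨b, rfl⟩ := Int.dvd_of_emod_eq_zero h'
    exact ⟨a, c, b, by linarith⟩

lemma isCoprime_two_pow_of_odd {y : ℤ} (hy : y % 2 = 1) (k : ℕ) : IsCoprime y (2 ^ k) :=
  IsCoprime.pow_right ⟨1, -(y / 2), by omega⟩

/-- The form `x² + 2y² + 4z² + 10w²` primitively represents `n`. -/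
def PrimitivelyRepresents (n : ℕ) : Prop :=
  ∃ x y z w : ℤ, Int.gcd x (Int.gcd y (Int.gcd z w)) = 1 ∧
    x ^ 2 + 2 * y ^ 2 + 4 * z ^ 2 + 10 * w ^ 2 = (n : ℤ)

lemma primitivelyRepresents_of_odd {n : ℕ} (hn : n % 2 = 1) : PrimitivelyRepresents n := by
  by_cases hlt : n < 11
  · rcases (show n = 1 ∨ n = 3 ∨ n = 5 ∨ n = 7 ∨ n = 9 by omega) with
      rfl | rfl | rfl | rfl | rfl
    exacts [⟨1, 0, 0, 0, by decide⟩, ⟨1, 1, 0, 0, by decide⟩, ⟨1, 0, 1, 0, by decide⟩,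
      ⟨1, 1, 1, 0, by decide⟩, ⟨1, 2, 0, 0, by decide⟩]
  · obtain ⟨x, y, z, h⟩ := exists_eq_sq_add_two_sq_add_four_sq (k := n - 10) (by omega)
    exact ⟨x, y, z, 1, by simp, by push_cast [show 10 ≤ n by omega] at h; linarith⟩

lemma primitivelyRepresents_two_mul {t : ℕ} (ht : t % 4 = 2 ∨ t % 4 = 3 ∨ t % 8 = 0)
    (hpos : 0 < t) : PrimitivelyRepresents (2 * t) := by
  by_cases hlt : t < 5
  · rcases (show t = 2 ∨ t = 3 by omega) with rfl | rfl
    exacts [⟨0, 0, 1, 0, by decide⟩, ⟨2, 1, 0, 0, by decide⟩]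
  · obtain ⟨a, y, z, h⟩ := sum_sq_add_two_mul_of_sum_three_squares
      (sum_three_squares (n := t - 5) (by omega))
    push_cast [show 5 ≤ t by omega] at h
    exact ⟨2 * a, y, z, 1, by simp, by push_cast; linarith⟩

lemma primitivelyRepresents_two_mul_of_mod_four_eq_one {t : ℕ} (ht : t % 4 = 1) :
    PrimitivelyRepresents (2 * t) := by
  by_cases hlt : t < 21
  · rcases (show t = 1 ∨ t = 5 ∨ t = 9 ∨ t = 13 ∨ t = 17 by omega) with
      rfl | rfl | rfl | rfl | rfl
    exacts [⟨0, 1, 0, 0, by decide⟩, ⟨0, 0, 0, 1, by decide⟩, ⟨4, 1, 0, 0, by decide⟩,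
      ⟨4, 0, 0, 1, by decide⟩, ⟨4, 1, 2, 0, by decide⟩]
  · obtain ⟨a, y, z, h⟩ := sum_sq_add_two_mul_of_sum_three_squares
      (sum_three_squares (n := t - 20) (by omega))
    push_cast [show 20 ≤ t by omega] at h
    have hy : y % 2 = 1 := by have := sq_emod_four y; omega
    have hc := Int.isCoprime_iff_gcd_eq_one.mp (isCoprime_two_pow_of_odd hy 1)
    refine ⟨2 * a, y, z, 2, ?_, by push_cast; linarith⟩
    have : Int.gcd y (Int.gcd z 2) = 1 := by
      rw [Int.gcd_comm z, ← Int.gcd_assoc, show (2 : ℤ) = 2 ^ 1 from rfl, hc]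
      simp
    simp [this]

/-- Here all of `x`, `y`, `w` are even, so primitivity forces `z` to be odd. -/
lemma primitivelyRepresents_eight_mul {s : ℕ} (hs : s % 2 = 1) (h3 : s ≠ 3) :
    PrimitivelyRepresents (8 * s) := by
  by_cases hlt : s < 5 ∨ s < 21 ∧ s % 4 = 1
  · rcases (show s = 1 ∨ s = 5 ∨ s = 9 ∨ s = 13 ∨ s = 17 by omega) with
      rfl | rfl | rfl | rfl | rfl
    exacts [⟨2, 0, 1, 0, by decide⟩, ⟨6, 0, 1, 0, by decide⟩, ⟨6, 4, 1, 0, by decide⟩,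
      ⟨10, 0, 1, 0, by decide⟩, ⟨10, 4, 1, 0, by decide⟩]
  · obtain ⟨k, hk, hmod⟩ : ∃ k : ℕ, 5 * (2 ^ k) ^ 2 ≤ s ∧
        ((s - 5 * (2 ^ k) ^ 2) % 4 = 1 ∨ (s - 5 * (2 ^ k) ^ 2) % 4 = 2) := by
      rcases (show s % 4 = 3 ∨ s % 4 = 1 by omega) with h | h
      · exact ⟨0, by omega, by omega⟩
      · exact ⟨1, by omega, by omega⟩
    obtain ⟨u, v, y, h, huv⟩ := exists_mixed_parity hmod
    push_cast [hk] at h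
    have hc := Int.isCoprime_iff_gcd_eq_one.mp
      (isCoprime_two_pow_of_odd (show (u - v) % 2 = 1 by omega) (k + 1))
    exact ⟨2 * (u + v), 2 * y, u - v, 2 ^ (k + 1), by simp [hc], by
      push_cast; linear_combination 8 * h⟩

set_option maxRecDepth 20000 in
lemma not_primitivelyRepresents_twenty_four : ¬ PrimitivelyRepresents 24 := by
  rintro ⟨x, y, z, w, hgcd, h⟩
  push_cast at h
  have hx : x ∈ Finset.Icc (-4 : ℤ) 4 := by
    rw [Finset.mem_Icc]; constructor <;> nlinarith [sq_nonneg y, sq_nonneg z, sq_nonneg w]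
  have hy : y ∈ Finset.Icc (-3 : ℤ) 3 := by
    rw [Finset.mem_Icc]; constructor <;> nlinarith [sq_nonneg x, sq_nonneg z, sq_nonneg w]
  have hz : z ∈ Finset.Icc (-2 : ℤ) 2 := by
    rw [Finset.mem_Icc]; constructor <;> nlinarith [sq_nonneg x, sq_nonneg y, sq_nonneg w]
  have hw : w ∈ Finset.Icc (-1 : ℤ) 1 := by
    rw [Finset.mem_Icc]; constructor <;> nlinarith [sq_nonneg x, sq_nonneg y, sq_nonneg z]
  have key : ∀ x ∈ Finset.Icc (-4 : ℤ) 4, ∀ y ∈ Finset.Icc (-3 : ℤ) 3,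
      ∀ z ∈ Finset.Icc (-2 : ℤ) 2, ∀ w ∈ Finset.Icc (-1 : ℤ) 1,
      x ^ 2 + 2 * y ^ 2 + 4 * z ^ 2 + 10 * w ^ 2 = 24 →
        Int.gcd x (Int.gcd y (Int.gcd z w)) ≠ 1 := by
    decide
  exact key x hx y hy z hz w hw h hgcd

theorem stmt_10 (n : ℕ) (hn : 0 < n) :
    (∃ x y z w : ℤ, Int.gcd x (Int.gcd y (Int.gcd z w)) = 1 ∧
      x ^ 2 + 2 * y ^ 2 + 4 * z ^ 2 + 10 * w ^ 2 = (n : ℤ)) ↔ n ≠ 24 := by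
  change PrimitivelyRepresents n ↔ n ≠ 24
  refine ⟨?_, fun h24 => ?_⟩
  · rintro h rfl
    exact not_primitivelyRepresents_twenty_four h
  · rcases Nat.mod_two_eq_zero_or_one n with h | h
    · obtain ⟨t, rfl⟩ := Nat.dvd_of_mod_eq_zero h
      rcases (show (t % 4 = 2 ∨ t % 4 = 3 ∨ t % 8 = 0) ∨ t % 4 = 1 ∨ t % 8 = 4 by omega) with
        ht | ht | ht
      · exact primitivelyRepresents_two_mul ht (by omega)
      · exact primitivelyRepresents_two_mul_of_mod_four_eq_one ht
      · obtain ⟨s, rfl⟩ : 4 ∣ t := by omega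
        rw [show 2 * (4 * s) = 8 * s by ring]
        exact primitivelyRepresents_eight_mul (by omega) (by omega)
    · exact primitivelyRepresents_of_odd h
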